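/- arXiv:2404.18438 — 4 statements merged into one kernel-verified Lean document; each statement's English description precedes it below -/
import Mathlib

section
/- Let q = 3, m ≥ 2, and N = 3^m - 1. If m is even, then T_{(1,n)} = { 3^m - 1 - i : i ∈ T_{(0,n)} }. If m is odd, then for each h ∈ {0,1} and every i ∈ T_{(h,n)}, also 3^m - 1 - i ∈ T_{(h,n)}. -/
/-- The Hamming weight of a natural number in base `q`:
the number of nonzero base-`q` digits. -/
def hwt (q i : ℕ) : ℕ := ((Nat.digits q i).filter (· ≠ 0)).length

/-- For `q` odd, `m ≥ 2`, `N = q^m - 1` and `j ∈ {0,1}`, the set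
`T_{(j,n)} = { h : 1 ≤ h ≤ N-1, h odd, wt(h) ≡ j (mod 2) }`. -/
def Tset (q m j : ℕ) : Finset ℕ :=
  (Finset.Icc 1 (q ^ m - 1 - 1)).filter (fun h => h % 2 = 1 ∧ hwt q h % 2 = j)

theorem hwt_zero (q : ℕ) : hwt q 0 = 0 := by simp [hwt]

theorem hwt_eq_add_hwt_div {q : ℕ} (hq : 2 ≤ q) (n : ℕ) :
    hwt q n = (if n % q = 0 then 0 else 1) + hwt q (n / q) := by
  rcases Nat.eq_zero_or_pos n with rfl | hn
  · simp [hwt_zero]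
  · unfold hwt
    rw [Nat.digits_def' (by omega) hn, List.filter_cons]
    by_cases h : n % q = 0 <;> simp [h, add_comm]

/-- Replacing each of the `m` ternary digits `d` of `i` by `2 - d` gives `3 ^ m - 1 - i`; the
digits equal to `1` are counted in both weights, and their number has the parity of `i`. -/
theorem hwt_three_add_hwt_complement_mod_two (m i : ℕ) (hi : i < 3 ^ m) :
    (hwt 3 i + hwt 3 (3 ^ m - 1 - i)) % 2 = (m + i) % 2 := by
  induction m generalizing i with
  | zero =>
    obtain rfl : i = 0 := by simpa using hi
    simp [hwt_zero]
  | succ m ih =>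
    rw [pow_succ] at hi ⊢
    have hdiv : (3 ^ m * 3 - 1 - i) / 3 = 3 ^ m - 1 - i / 3 := by omega
    have hmod : (3 ^ m * 3 - 1 - i) % 3 = 2 - i % 3 := by omega
    have := ih (i / 3) (by omega)
    rw [hwt_eq_add_hwt_div (by norm_num) i,
      hwt_eq_add_hwt_div (by norm_num) (3 ^ m * 3 - 1 - i), hdiv, hmod]
    split_ifs <;> omega

theorem mem_Tset {q m j h : ℕ} :
    h ∈ Tset q m j ↔ (1 ≤ h ∧ h ≤ q ^ m - 1 - 1) ∧ h % 2 = 1 ∧ hwt q h % 2 = j := by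
  simp [Tset]

/-- On odd numbers the digit complement shifts the weight parity by `m + 1`. -/
theorem complement_mem_Tset_three {m j k i : ℕ} (hk : k < 2) (hjk : (j + k) % 2 = (m + 1) % 2)
    (hi : i ∈ Tset 3 m j) : 3 ^ m - 1 - i ∈ Tset 3 m k := by
  rw [mem_Tset] at hi ⊢
  have hodd : 3 ^ m % 2 = 1 := Nat.odd_iff.mp (Odd.pow (by decide))
  have := hwt_three_add_hwt_complement_mod_two m i (by omega)
  omega

/-- Let `q = 3`, `m ≥ 2` and `N = 3^m - 1`. If `m` is even, then
`T_{(1,n)} = { 3^m - 1 - i : i ∈ T_{(0,n)} }`; if `m` is odd, then for each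
`h ∈ {0,1}` and every `i ∈ T_{(h,n)}`, also `3^m - 1 - i ∈ T_{(h,n)}`. -/
theorem stmt3 (m : ℕ) (hm : 2 ≤ m) (N : ℕ) (hN : N = 3 ^ m - 1) :
    (Even m → Tset 3 m 1 = (Tset 3 m 0).image (fun i => N - i)) ∧
    (Odd m → ∀ h ∈ ({0, 1} : Finset ℕ), ∀ i ∈ Tset 3 m h, N - i ∈ Tset 3 m h) := by
  subst hN
  refine ⟨fun hev => ?_, fun hodd h hh i hi => ?_⟩
  · rw [Nat.even_iff] at hev
    ext x
    rw [Finset.mem_image]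
    refine ⟨fun hx => ⟨3 ^ m - 1 - x, complement_mem_Tset_three (by norm_num) (by omega) hx, ?_⟩, ?_⟩
    · have := mem_Tset.mp hx
      omega
    · rintro ⟨i, hi, rfl⟩
      exact complement_mem_Tset_three (by norm_num) (by omega) hi
  · rw [Nat.odd_iff] at hodd
    have hlt : h < 2 := by
      simp only [Finset.mem_insert, Finset.mem_singleton] at hh
      omega
    exact complement_mem_Tset_three hlt (by omega) hi
end

section
/- Let q ≥ 3 be an odd prime power, m ≥ 3 an odd integer, and h = (m-1)/2. Then for every integer i with 0 ≤ i ≤ (q-1)·q^{h-1} - 1, the integer 2·q^{2h-1} + q^{h-1} + (q^h + 1)·i is an odd positive integer at most q^m - 2 whose Hamming weight (in base q) is even; that is, it belongs to T_{(0,n)}. -/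
theorem hwt_add_mul {q : ℕ} (hq : 2 ≤ q) {d : ℕ} (hd : d < q) (n : ℕ) :
    hwt q (d + q * n) = hwt q d + hwt q n := by
  rcases Nat.eq_zero_or_pos d with rfl | hd0
  · rcases Nat.eq_zero_or_pos n with rfl | hn
    · simp [hwt]
    · simp [hwt, Nat.digits_base_mul (by omega : 1 < q) hn]
  · have h1 : Nat.digits q (d + q * n) = d :: Nat.digits q n :=
      Nat.digits_add q (by omega) d n hd (Or.inl hd0.ne')
    have h2 : Nat.digits q d = [d] := Nat.digits_of_lt q d hd0.ne' hd
    simp only [hwt, h1, h2]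
    simp [hd0.ne']
    omega

theorem hwt_add_pow_mul {q : ℕ} (hq : 2 ≤ q) (k : ℕ) {r : ℕ} (hr : r < q ^ k) (n : ℕ) :
    hwt q (r + q ^ k * n) = hwt q r + hwt q n := by
  induction k generalizing r with
  | zero =>
    obtain rfl : r = 0 := by simpa using hr
    simp [hwt]
  | succ k ih =>
    have hd : r % q < q := Nat.mod_lt _ (by omega)
    have hs : r / q < q ^ k := Nat.div_lt_of_lt_mul (by rwa [pow_succ'] at hr)
    have e : r % q + q * (r / q) = r := Nat.mod_add_div r q
    have h1 : r + q ^ (k + 1) * n = r % q + q * (r / q + q ^ k * n) := by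
      conv_lhs => rw [← e]
      ring
    have h2 : hwt q r = hwt q (r % q) + hwt q (r / q) := by
      conv_lhs => rw [← e]
      exact hwt_add_mul hq hd _
    rw [h1, hwt_add_mul hq hd, ih hs, h2, add_assoc]

theorem hwt_eq_one {q : ℕ} (hq : 2 ≤ q) {d : ℕ} (hd0 : d ≠ 0) (hd : d ≤ q) : hwt q d = 1 := by
  have of_lt {c : ℕ} (hc0 : c ≠ 0) (hc : c < q) : hwt q c = 1 := by
    simp [hwt, Nat.digits_of_lt q c hc0 hc, hc0]
  rcases hd.lt_or_eq with hlt | rfl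
  · exact of_lt hd0 hlt
  · have := hwt_add_mul hq (show 0 < d by omega) 1
    rw [of_lt one_ne_zero (by omega)] at this
    simpa [hwt] using this


/-- Let `q ≥ 3` be an odd prime power, `m ≥ 3` odd, and `h = (m-1)/2`. Then
for every integer `i` with `0 ≤ i ≤ (q-1)·q^{h-1} - 1`, the integer
`2·q^{2h-1} + q^{h-1} + (q^h + 1)·i` is an odd positive integer at most
`q^m - 2` whose Hamming weight in base `q` is even; that is, it belongs to
`T_{(0,n)}`. -/
theorem stmt6 (q m : ℕ) (hq : 3 ≤ q) (hodd : Odd q) (hpp : IsPrimePow q)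
    (hm : 3 ≤ m) (hmo : Odd m) (h : ℕ) (hh : h = (m - 1) / 2)
    (i : ℕ) (hi : i ≤ (q - 1) * q ^ (h - 1) - 1) :
    ∀ x : ℕ, x = 2 * q ^ (2 * h - 1) + q ^ (h - 1) + (q ^ h + 1) * i →
      Odd x ∧ 1 ≤ x ∧ x ≤ q ^ m - 2 ∧ Even (hwt q x) := by
  rintro x rfl
  obtain ⟨k, rfl⟩ : ∃ k, h = k + 1 := ⟨h - 1, by omega⟩
  obtain rfl : m = 2 * (k + 1) + 1 := by
    obtain ⟨t, rfl⟩ := hmo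
    omega
  simp only [Nat.add_sub_cancel] at hi ⊢
  rw [show 2 * (k + 1) - 1 = 2 * k + 1 by omega]
  have hQ : 0 < q ^ k := pow_pos (by omega) k
  have hlt : i < (q - 1) * q ^ k := by
    have : 0 < (q - 1) * q ^ k := Nat.mul_pos (by omega) hQ
    omega
  have hr : i % q ^ k < q ^ k := Nat.mod_lt _ hQ
  have ha : i / q ^ k < q - 1 := Nat.div_lt_of_lt_mul (by rwa [mul_comm])
  have e : i % q ^ k + q ^ k * (i / q ^ k) = i := Nat.mod_add_div i _
  generalize i % q ^ k = r at hr e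
  generalize i / q ^ k = a at ha e
  subst e
  refine ⟨?_, by omega, ?_, ?_⟩
  · have h1 : Odd (q ^ k) := hodd.pow
    have h2 : Even (q ^ (k + 1) + 1) := hodd.pow.add_one
    exact ((even_two_mul _).add_odd h1).add_even (h2.mul_right _)
  · have h1 : r + q ^ k * a + q ^ k + 1 ≤ q ^ (k + 1) := by
      obtain ⟨p, rfl⟩ : ∃ p, q = p + 1 := ⟨q - 1, by omega⟩
      have : (p + 1) ^ k * (a + 2) ≤ (p + 1) ^ k * (p + 1) := Nat.mul_le_mul_left _ (by omega)
      rw [pow_succ]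
      nlinarith
    have h3 : 3 * q ^ k ≤ q ^ (k + 1) := by
      rw [pow_succ, mul_comm]
      exact Nat.mul_le_mul_left _ hq
    have h4 : q ^ (2 * k + 1) = q ^ (k + 1) * q ^ k := by ring
    have h5 : q ^ (2 * (k + 1) + 1) = q * (q ^ (k + 1) * q ^ (k + 1)) := by ring
    have h6 : 3 * (q ^ (k + 1) * q ^ (k + 1)) ≤ q * (q ^ (k + 1) * q ^ (k + 1)) :=
      Nat.mul_le_mul_right _ hq
    rw [h4, h5]
    generalize q ^ (k + 1) = P at *
    generalize r + q ^ k * a = j at *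
    generalize q ^ k = Q at *
    have h7 : P * (3 * Q) ≤ P * P := Nat.mul_le_mul_left _ h3
    have h8 : P * (j + Q + 1) ≤ P * P := Nat.mul_le_mul_left _ (by omega)
    have h9 : 3 * P ≤ P * P := Nat.mul_le_mul_right _ (by omega)
    apply Nat.le_sub_of_add_le
    nlinarith
  · have h1 : r + q ^ k * (a + 1) < q ^ (k + 1) := by
      have : q ^ k * (a + 2) ≤ q ^ k * q := Nat.mul_le_mul_left _ (by omega)
      rw [pow_succ]
      nlinarith
    have h2 : 2 * q ^ (2 * k + 1) + q ^ k + (q ^ (k + 1) + 1) * (r + q ^ k * a) =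
        (r + q ^ k * (a + 1)) + q ^ (k + 1) * (r + q ^ k * (a + 2)) := by ring
    have hq2 : 2 ≤ q := by omega
    rw [h2, hwt_add_pow_mul hq2 _ h1, hwt_add_pow_mul hq2 _ hr, hwt_add_pow_mul hq2 _ hr,
      hwt_eq_one hq2 a.succ_ne_zero (by omega),
      hwt_eq_one hq2 (a + 1).succ_ne_zero (by omega)]
    exact ⟨_, rfl⟩
end

section
/- Let q ≥ 5 be an odd prime power and m = 2^e·ℓ, where ℓ ≥ 3 is odd and e ≥ 1. Let N = q^m - 1 and h = (m + 2^e)/2. Then for every integer i with -(q-2) ≤ i ≤ q^{h - 2^e}, the integer (q^{h - 2^e + 1} + (q^h + 1)·i) mod N is odd and its Hamming weight (in base q) is odd; that is, it belongs to T_{(1,n)}. -/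
theorem hwt_mul_add {q : ℕ} (hq : 1 < q) (b r : ℕ) (hr : r < q) :
    hwt q (q * b + r) = hwt q b + if r = 0 then 0 else 1 := by
  by_cases h : q * b + r = 0
  · have hr0 : r = 0 := by omega
    have hb : b = 0 := by
      have : q * b = 0 := by omega
      rcases Nat.mul_eq_zero.mp this with h | h <;> omega
    subst hr0 hb
    simp [hwt]
  · have hmod : (q * b + r) % q = r := by
      rw [Nat.mul_add_mod, Nat.mod_eq_of_lt hr]
    have hdiv : (q * b + r) / q = b := by
      rw [Nat.mul_add_div (by omega), Nat.div_eq_of_lt hr, add_zero]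
    unfold hwt
    rw [Nat.digits_def' hq (Nat.pos_of_ne_zero h), hmod, hdiv, List.filter_cons]
    by_cases hr0 : r = 0 <;> simp [hr0]

theorem hwt_lt {q r : ℕ} (hq : 1 < q) (hr : r < q) (hr0 : r ≠ 0) : hwt q r = 1 := by
  simpa [hwt_zero, hr0] using hwt_mul_add hq 0 r hr

theorem hwt_pow_mul_add {q : ℕ} (hq : 1 < q) (n b a : ℕ) (ha : a < q ^ n) :
    hwt q (q ^ n * b + a) = hwt q b + hwt q a := by
  induction n generalizing a with
  | zero =>
    obtain rfl : a = 0 := by simpa using ha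
    simp [hwt_zero]
  | succ n ih =>
    have hlt : a % q < q := Nat.mod_lt _ (by omega)
    have hdiv : a / q < q ^ n := Nat.div_lt_of_lt_mul (by rwa [pow_succ'] at ha)
    have hA : hwt q a = hwt q (a / q) + if a % q = 0 then 0 else 1 := by
      rw [← hwt_mul_add hq _ _ hlt, Nat.div_add_mod]
    have hsplit : q ^ (n + 1) * b + a = q * (q ^ n * b + a / q) + a % q := by
      conv_lhs => rw [← Nat.div_add_mod a q]
      ring
    rw [hsplit, hwt_mul_add hq _ _ hlt, ih _ hdiv, hA, add_assoc]

theorem hwt_pow {q : ℕ} (hq : 1 < q) (n : ℕ) : hwt q (q ^ n) = 1 := by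
  simpa [hwt_zero, hwt_lt hq hq one_ne_zero] using
    hwt_pow_mul_add hq n 1 0 (Nat.pow_pos (by omega))

theorem hwt_pow_sub_one {q : ℕ} (hq : 1 < q) (n : ℕ) : hwt q (q ^ n - 1) = n := by
  induction n with
  | zero => simp [hwt_zero]
  | succ n ih =>
    have hpos : 1 ≤ q ^ n := Nat.one_le_pow _ _ (by omega)
    have hsplit : q ^ (n + 1) - 1 = q * (q ^ n - 1) + (q - 1) := by
      have : q * 1 ≤ q * q ^ n := Nat.mul_le_mul_left _ hpos
      rw [pow_succ', Nat.mul_sub]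
      omega
    rw [hsplit, hwt_mul_add hq _ _ (by omega), ih, if_neg (by omega)]

theorem hwt_pow_succ_sub {q : ℕ} (hq : 1 < q) (n j : ℕ) (hj : 1 ≤ j) (hjq : j < q) :
    hwt q (q ^ (n + 1) - j) = n + 1 := by
  have hpos : 1 ≤ q ^ n := Nat.one_le_pow _ _ (by omega)
  have hsplit : q ^ (n + 1) - j = q * (q ^ n - 1) + (q - j) := by
    have : q * 1 ≤ q * q ^ n := Nat.mul_le_mul_left _ hpos
    rw [pow_succ', Nat.mul_sub]
    omega
  rw [hsplit, hwt_mul_add hq _ _ (by omega), hwt_pow_sub_one hq, if_neg (by omega)]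

/-- The residue of `q ^ (k + 1) + (q ^ h + 1) * i` modulo `q ^ (h + k) - 1` has a
representative in `[0, q ^ (h + k) - 1)` whose weight is odd. -/
theorem exists_rep_odd_hwt {q h k : ℕ} (hq : 5 ≤ q) (hk : 2 ≤ k) (hhk : k + 2 ≤ h) (i : ℤ)
    (hi1 : -((q : ℤ) - 2) ≤ i) (hi2 : i ≤ (q : ℤ) ^ k) :
    ∃ (y : ℕ) (t : ℤ), (q : ℤ) ^ (k + 1) + (q ^ h + 1) * i = y + ((q : ℤ) ^ (h + k) - 1) * t ∧
      (y : ℤ) < (q : ℤ) ^ (h + k) - 1 ∧ Odd (hwt q y) := by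
  have hq1 : 1 < q := by omega
  have hk0 : 25 ≤ q ^ k := by
    calc 25 ≤ q ^ 2 := by nlinarith
      _ ≤ q ^ k := Nat.pow_le_pow_right (by omega) hk
  have hk1 : 5 * q ^ k ≤ q ^ (k + 1) := by
    rw [pow_succ']; exact Nat.mul_le_mul_right _ hq
  have hh1 : 5 * q ^ (k + 1) ≤ q ^ h := by
    calc 5 * q ^ (k + 1) ≤ q * q ^ (k + 1) := Nat.mul_le_mul_right _ hq
      _ = q ^ (k + 2) := by ring
      _ ≤ q ^ h := Nat.pow_le_pow_right (by omega) hhk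
  have hm : q ^ (h + k) = q ^ h * q ^ k := pow_add _ _ _
  have hqk : q ≤ q ^ k := Nat.le_self_pow (by omega) q
  rcases lt_or_ge i 0 with hneg | hnn
  · obtain ⟨j, rfl⟩ : ∃ j : ℕ, i = -(j : ℤ) := ⟨i.natAbs, by omega⟩
    have hj1 : 1 ≤ j := by omega
    have hj2 : j + 2 ≤ q := by omega
    refine ⟨q ^ h * (q ^ k - j) + (q ^ (k + 1) - (j + 1)), -1, ?_, ?_, ?_⟩
    · push_cast [Nat.cast_sub (show j ≤ q ^ k by omega),
        Nat.cast_sub (show j + 1 ≤ q ^ (k + 1) by omega)]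
      ring
    · have h1 : q ^ h * (q ^ k - j) ≤ q ^ h * (q ^ k - 1) := Nat.mul_le_mul_left _ (by omega)
      have h2 : q ^ h * (q ^ k - 1) + q ^ h = q ^ (h + k) := by
        rw [hm, ← Nat.mul_succ]; congr 1; omega
      have h3 : q ^ h * (q ^ k - j) + (q ^ (k + 1) - (j + 1)) + 1 < q ^ (h + k) := by omega
      rw [lt_sub_iff_add_lt]
      exact_mod_cast h3
    · obtain ⟨k, rfl⟩ : ∃ n, k = n + 1 := ⟨k - 1, by omega⟩
      rw [hwt_pow_mul_add hq1 _ _ _ (by omega), hwt_pow_succ_sub hq1 _ _ hj1 (by omega),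
        hwt_pow_succ_sub hq1 _ _ (by omega) (by omega)]
      exact ⟨k + 1, by ring⟩
  · obtain ⟨j, rfl⟩ := Int.eq_ofNat_of_zero_le hnn
    have hj : j ≤ q ^ k := by exact_mod_cast hi2
    rcases hj.lt_or_eq with hlt | rfl
    · refine ⟨q ^ h * j + (q ^ k * q + j), 0, by push_cast; ring, ?_, ?_⟩
      · have h1 : q ^ h * j ≤ q ^ h * (q ^ k - 1) := Nat.mul_le_mul_left _ (by omega)
        have h2 : q ^ h * (q ^ k - 1) + q ^ h = q ^ (h + k) := by
          rw [hm, ← Nat.mul_succ]; congr 1; omega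
        have h3 : q ^ h * j + (q ^ k * q + j) + 1 < q ^ (h + k) := by
          rw [← pow_succ]; omega
        rw [lt_sub_iff_add_lt]
        exact_mod_cast h3
      · have hlt' : q ^ k * q + j < q ^ h := by rw [← pow_succ]; omega
        have hwq : hwt q q = 1 := by simpa using hwt_pow hq1 1
        rw [hwt_pow_mul_add hq1 _ _ _ hlt', hwt_pow_mul_add hq1 _ _ _ hlt, hwq]
        exact ⟨hwt q j, by ring⟩
    · refine ⟨q ^ k * (q * 1 + 1) + 1, 1, by push_cast; ring, ?_, ?_⟩
      · have h1 : q ^ h * 25 ≤ q ^ (h + k) := hm ▸ Nat.mul_le_mul_left _ hk0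
        have h3 : q ^ k * (q * 1 + 1) + 1 + 1 < q ^ (h + k) := by
          have : q ^ k * (q * 1 + 1) = q ^ (k + 1) + q ^ k := by ring
          omega
        rw [lt_sub_iff_add_lt]
        exact_mod_cast h3
      · rw [hwt_pow_mul_add hq1 _ _ _ (by omega), hwt_mul_add hq1 _ _ hq1,
          hwt_lt hq1 hq1 one_ne_zero]
        decide

/-- Let `q ≥ 5` be an odd prime power and `m = 2^e·ℓ` with `ℓ ≥ 3` odd and
`e ≥ 1`. Let `N = q^m - 1` and `h = (m + 2^e)/2`. Then for every integer `i`
with `-(q-2) ≤ i ≤ q^{h - 2^e}`, the integer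
`(q^{h - 2^e + 1} + (q^h + 1)·i) mod N` is odd, lies in `{1, …, N-1}`, and
its Hamming weight in base `q` is odd; that is, it belongs to `T_{(1,n)}`. -/
theorem stmt7 (q m e l : ℕ) (hq : 5 ≤ q) (hodd : Odd q) (hpp : IsPrimePow q)
    (hl : 3 ≤ l) (hlo : Odd l) (he : 1 ≤ e) (hm : m = 2 ^ e * l)
    (N : ℤ) (hN : N = (q : ℤ) ^ m - 1) (h : ℕ) (hh : h = (m + 2 ^ e) / 2)
    (i : ℤ) (hi1 : -((q : ℤ) - 2) ≤ i) (hi2 : i ≤ (q : ℤ) ^ (h - 2 ^ e)) :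
    ∀ x : ℤ, x = ((q : ℤ) ^ (h - 2 ^ e + 1) + ((q : ℤ) ^ h + 1) * i) % N →
      Odd x ∧ 1 ≤ x ∧ x ≤ N - 1 ∧ Odd (hwt q x.toNat) := by
  rintro x rfl
  obtain ⟨c, rfl⟩ := hlo
  have ha : 2 ≤ 2 ^ e := Nat.le_self_pow (by omega) 2
  have hac : 2 ^ e * 1 ≤ 2 ^ e * c := Nat.mul_le_mul_left _ (by omega)
  have hm' : m = 2 * (2 ^ e * c) + 2 ^ e := by rw [hm]; ring
  have hmhk : m = h + (h - 2 ^ e) := by omega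
  have hk : 2 ≤ h - 2 ^ e := by omega
  have hhk : h - 2 ^ e + 2 ≤ h := by omega
  generalize h - 2 ^ e = k at *
  obtain ⟨y, t, hy, hyN, hw⟩ := exists_rep_odd_hwt hq hk hhk i hi1 hi2
  rw [← hmhk, ← hN] at hy hyN
  have hx : ((q : ℤ) ^ (k + 1) + ((q : ℤ) ^ h + 1) * i) % N = y := by
    rw [hy, Int.add_mul_emod_self_left, Int.emod_eq_of_lt (by positivity) hyN]
  rw [hx]
  have hqo : Odd (q : ℤ) := by exact_mod_cast hodd
  have hyo : Odd (y : ℤ) := by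
    have hNe : Even (N * t) := by rw [hN]; exact (hqo.pow.sub_odd odd_one).mul_right t
    have hle : Odd ((q : ℤ) ^ (k + 1) + ((q : ℤ) ^ h + 1) * i) :=
      hqo.pow.add_even ((hqo.pow.add_odd odd_one).mul_right i)
    rw [hy] at hle
    exact (Int.odd_add.mp hle).mpr hNe
  refine ⟨hyo, ?_, by omega, by simpa using hw⟩
  obtain ⟨z, hz⟩ := hyo
  omega
end

section
/- Let q ≥ 3 be a prime power and m ≥ 4 with m ≡ 0 (mod 4). Then: (1) for every 0 ≤ ℓ ≤ (m-4)/2 and every 0 ≤ i ≤ 2q^ℓ - 1, wt_q(2q^ℓ - 1 + (q^{(m+2)/2} - 1)·i) = 1 + (q-1)ℓ; (2) for ℓ = (m-2)/2 and every 1 ≤ i ≤ q^ℓ, wt_q(q^{m-1} + (q^{(m-2)/2} - 1)·i) = 1 + (q-1)ℓ; (3) for ℓ = m/2 and every 1 ≤ i ≤ q^{(m-2)/2}, wt_q(2q^{m-1} - 1 - (q^{(m-2)/2} - 1)·i) = 1 + (q-1)ℓ; (4) for every (m+2)/2 ≤ ℓ ≤ m - 1 and every 0 ≤ i ≤ (q-1)·q^{m-1-ℓ}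 - 1, wt_q(q^m - (q-1)·q^{m-1-ℓ} - (q^{(m+2)/2} - 1)·i) = 1 + (q-1)ℓ. In particular all these integers lie in T_{(q,m,ℓ)}. -/
/-- The `q`-weight of a natural number: the sum of its base-`q` digits. -/
def wtq (q i : ℕ) : ℕ := (Nat.digits q i).sum

theorem wtq_mul_add {q : ℕ} (hq : 2 ≤ q) (a : ℕ) {b : ℕ} (hb : b < q) :
    wtq q (a * q + b) = wtq q a + b := by
  unfold wtq
  rcases Nat.eq_zero_or_pos (a * q + b) with h | h
  · have hb0 : b = 0 := by omega
    have ha : a = 0 := by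
      have : a * q = 0 := by omega
      rcases Nat.mul_eq_zero.mp this with h | h <;> omega
    simp [ha, hb0]
  · have hmod : (a * q + b) % q = b := by
      rw [Nat.mul_add_mod_self_right, Nat.mod_eq_of_lt hb]
    have hdiv : (a * q + b) / q = a := by
      rw [mul_comm, Nat.mul_add_div (by omega), Nat.div_eq_of_lt hb, add_zero]
    rw [Nat.digits_def' (by omega) h, hmod, hdiv, List.sum_cons, add_comm]

theorem wtq_of_lt {q : ℕ} (hq : 2 ≤ q) {b : ℕ} (hb : b < q) : wtq q b = b := by
  simpa [wtq] using wtq_mul_add hq 0 hb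

theorem wtq_mul_pow_add {q : ℕ} (hq : 2 ≤ q) (a k : ℕ) {b : ℕ} (hb : b < q ^ k) :
    wtq q (a * q ^ k + b) = wtq q a + wtq q b := by
  induction k generalizing b with
  | zero =>
    obtain rfl : b = 0 := by simpa using hb
    simp [wtq]
  | succ k ih =>
    have hr : b % q < q := Nat.mod_lt _ (by omega)
    have hd : b / q < q ^ k := Nat.div_lt_of_lt_mul (by rwa [pow_succ'] at hb)
    have hb' : b / q * q + b % q = b := Nat.div_add_mod' b q
    have e : a * q ^ (k + 1) + b = (a * q ^ k + b / q) * q + b % q := by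
      rw [add_mul, add_assoc, hb', pow_succ, mul_assoc]
    rw [e, wtq_mul_add hq _ hr, ih hd, add_assoc, ← wtq_mul_add hq _ hr, hb']

/-- Subtracting from `a * q ^ l - 1`, whose digits below the leading one are all `q - 1`,
never borrows. -/
theorem wtq_add_wtq_complement {q : ℕ} (hq : 2 ≤ q) {a l i j : ℕ} (ha : a ≤ q)
    (h : i + j + 1 = a * q ^ l) : wtq q i + wtq q j + 1 = a + (q - 1) * l := by
  induction l generalizing i j with
  | zero =>
    simp only [pow_zero, mul_one, mul_zero, add_zero] at h ⊢
    rw [wtq_of_lt hq (by omega), wtq_of_lt hq (by omega), h]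
  | succ l ih =>
    have hr : i % q < q := Nat.mod_lt _ (by omega)
    have hi : i / q * q + i % q = i := Nat.div_add_mod' i q
    have hd : i / q < a * q ^ l := by
      apply Nat.div_lt_of_lt_mul
      calc i < a * q ^ (l + 1) := by omega
        _ = q * (a * q ^ l) := by ring
    obtain ⟨t, ht⟩ := Nat.exists_eq_add_of_lt hd
    have hj : j = t * q + (q - 1 - i % q) := by
      have e : a * q ^ (l + 1) = i / q * q + t * q + q := by
        rw [pow_succ, ← mul_assoc, ht]; ring
      omega
    have := ih ht.symm
    have e1 : wtq q i = wtq q (i / q) + i % q := by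
      rw [← wtq_mul_add hq _ hr, hi]
    rw [e1, hj, wtq_mul_add hq t (by omega), mul_add, mul_one]
    omega

/-- Multiplication by `q ^ h - 1` of a short number, seen as a concatenation of two
complementary blocks of digits. -/
theorem wtq_mul_pow_add_complement {q : ℕ} (hq : 2 ≤ q) {a l h i j : ℕ} (ha : a ≤ q)
    (hij : i + j + 1 = a * q ^ l) (hle : a * q ^ l ≤ q ^ h) :
    wtq q (i * q ^ h + j) + 1 = a + (q - 1) * l := by
  rw [wtq_mul_pow_add hq i h (by omega), wtq_add_wtq_complement hq ha hij]

/-- Let `q ≥ 3` be a prime power and `m ≥ 4` with `m ≡ 0 (mod 4)`. Then: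
(1) for `0 ≤ ℓ ≤ (m-4)/2` and `0 ≤ i ≤ 2q^ℓ - 1`,
    `wt_q(2q^ℓ - 1 + (q^{(m+2)/2} - 1)·i) = 1 + (q-1)ℓ`;
(2) for `ℓ = (m-2)/2` and `1 ≤ i ≤ q^ℓ`,
    `wt_q(q^{m-1} + (q^{(m-2)/2} - 1)·i) = 1 + (q-1)ℓ`;
(3) for `ℓ = m/2` and `1 ≤ i ≤ q^{(m-2)/2}`,
    `wt_q(2q^{m-1} - 1 - (q^{(m-2)/2} - 1)·i) = 1 + (q-1)ℓ`;
(4) for `(m+2)/2 ≤ ℓ ≤ m - 1` and `0 ≤ i ≤ (q-1)q^{m-1-ℓ} - 1`,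
    `wt_q(q^m - (q-1)q^{m-1-ℓ} - (q^{(m+2)/2} - 1)·i) = 1 + (q-1)ℓ`.
In particular all these integers lie in `T_{(q,m,ℓ)}`. -/
theorem stmt14 (q m : ℕ) (hq : 3 ≤ q) (hpp : IsPrimePow q)
    (hm : 4 ≤ m) (hm4 : m % 4 = 0) :
    (∀ l i : ℕ, l ≤ (m - 4) / 2 → i ≤ 2 * q ^ l - 1 →
      wtq q (2 * q ^ l - 1 + (q ^ ((m + 2) / 2) - 1) * i) = 1 + (q - 1) * l) ∧
    (∀ i : ℕ, 1 ≤ i → i ≤ q ^ ((m - 2) / 2) →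
      wtq q (q ^ (m - 1) + (q ^ ((m - 2) / 2) - 1) * i)
        = 1 + (q - 1) * ((m - 2) / 2)) ∧
    (∀ i : ℕ, 1 ≤ i → i ≤ q ^ ((m - 2) / 2) →
      wtq q (2 * q ^ (m - 1) - 1 - (q ^ ((m - 2) / 2) - 1) * i)
        = 1 + (q - 1) * (m / 2)) ∧
    (∀ l i : ℕ, (m + 2) / 2 ≤ l → l ≤ m - 1 → i ≤ (q - 1) * q ^ (m - 1 - l) - 1 →
      wtq q (q ^ m - (q - 1) * q ^ (m - 1 - l) - (q ^ ((m + 2) / 2) - 1) * i)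
        = 1 + (q - 1) * l) := by
  have hq2 : 2 ≤ q := by omega
  have hq0 : 0 < q := by omega
  obtain ⟨s, rfl⟩ : ∃ s, m = 2 * s + 2 := ⟨(m - 2) / 2, by omega⟩
  rw [show (2 * s + 2 + 2) / 2 = s + 2 by omega, show (2 * s + 2 - 2) / 2 = s by omega,
    show (2 * s + 2) / 2 = s + 1 by omega, show (2 * s + 2 - 4) / 2 = s - 1 by omega,
    show 2 * s + 2 - 1 = 2 * s + 1 by omega]
  have hpow : ∀ n, 0 < q ^ n := fun n => Nat.pow_pos hq0
  have hsub : ∀ n i, (q ^ n - 1) * i = i * q ^ n - i := fun n i => by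
    rw [Nat.sub_mul, one_mul, mul_comm]
  have hile : ∀ n i, i ≤ i * q ^ n := fun n i => Nat.le_mul_of_pos_right i (hpow n)
  have hlt : ∀ i j : ℕ, i + j + 1 = 1 * q ^ s → i * q ^ s + j < q ^ (2 * s + 1) := by
    intro i j hij
    calc i * q ^ s + j < (i + 1) * q ^ s := by rw [add_mul]; omega
      _ ≤ q ^ s * q ^ s := Nat.mul_le_mul_right _ (by omega)
      _ = q ^ (2 * s) := by rw [← pow_add, two_mul]
      _ ≤ q ^ (2 * s + 1) := Nat.pow_le_pow_right hq0 (by omega)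
  refine ⟨?_, ?_, ?_, ?_⟩
  · intro l i hl hi
    have := hpow l
    have := hile (s + 2) i
    obtain ⟨j, hj⟩ : ∃ j, i + j + 1 = 2 * q ^ l := ⟨2 * q ^ l - 1 - i, by omega⟩
    have hle : 2 * q ^ l ≤ q ^ (s + 2) :=
      calc 2 * q ^ l ≤ q * q ^ l := Nat.mul_le_mul_right _ hq2
        _ = q ^ (l + 1) := (pow_succ' q l).symm
        _ ≤ q ^ (s + 2) := Nat.pow_le_pow_right hq0 (by omega)
    have key := wtq_mul_pow_add_complement hq2 hq2 hj hle
    rw [hsub, show 2 * q ^ l - 1 + (i * q ^ (s + 2) - i) = i * q ^ (s + 2) + j by omega]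
    omega
  · intro i h1 hi
    obtain ⟨i, rfl⟩ := Nat.exists_eq_add_of_le' h1
    obtain ⟨j, hj⟩ := Nat.exists_eq_add_of_le hi
    have hij : i + j + 1 = 1 * q ^ s := by omega
    have key := wtq_mul_pow_add_complement hq2 (h := s) (by omega) hij (by omega)
    have := hile s i
    rw [hsub, show q ^ (2 * s + 1) + ((i + 1) * q ^ s - (i + 1))
        = 1 * q ^ (2 * s + 1) + (i * q ^ s + j) by rw [add_mul]; omega,
      wtq_mul_pow_add hq2 1 _ (hlt i j hij), wtq_of_lt hq2 (by omega)]
    omega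
  · intro i h1 hi
    obtain ⟨i, rfl⟩ := Nat.exists_eq_add_of_le' h1
    obtain ⟨j, hj⟩ := Nat.exists_eq_add_of_le hi
    have hij : i + j + 1 = 1 * q ^ s := by omega
    have key := wtq_mul_pow_add_complement hq2 (h := s) (by omega) hij (by omega)
    have := hile s i
    have hx := hlt i j hij
    obtain ⟨y, hy⟩ := Nat.exists_eq_add_of_lt hx
    have hc := wtq_add_wtq_complement hq2 (a := 1) (by omega) (hy.symm.trans (one_mul _).symm)
    rw [hsub, show 2 * q ^ (2 * s + 1) - 1 - ((i + 1) * q ^ s - (i + 1))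
        = 1 * q ^ (2 * s + 1) + y by rw [add_mul]; omega,
      wtq_mul_pow_add hq2 1 _ (by omega), wtq_of_lt hq2 (by omega)]
    have e : (q - 1) * (2 * s + 1) = (q - 1) * s + (q - 1) * (s + 1) := by ring
    omega
  · intro l i hl hl' hi
    obtain ⟨k, hk⟩ : ∃ k, 2 * s + 1 = l + k := Nat.exists_eq_add_of_le hl'
    rw [show 2 * s + 1 - l = k by omega] at hi ⊢
    have hpos : 0 < (q - 1) * q ^ k := Nat.mul_pos (by omega) (hpow k)
    have hile' := hile (s + 2) i
    obtain ⟨j, hj⟩ : ∃ j, i + j + 1 = (q - 1) * q ^ k :=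
      ⟨(q - 1) * q ^ k - 1 - i, by omega⟩
    have hle' : (q - 1) * q ^ k ≤ q ^ (k + 1) := by
      rw [pow_succ']
      exact Nat.mul_le_mul_right _ (by omega)
    have hle : (q - 1) * q ^ k ≤ q ^ (s + 2) :=
      hle'.trans (Nat.pow_le_pow_right hq0 (by omega))
    have key := wtq_mul_pow_add_complement hq2 (by omega) hj hle
    have hx : i * q ^ (s + 2) + j < q ^ (2 * s + 2) :=
      calc i * q ^ (s + 2) + j < (i + 1) * q ^ (s + 2) := by rw [add_mul]; omega
        _ ≤ q ^ (k + 1) * q ^ (s + 2) := Nat.mul_le_mul_right _ (by omega)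
        _ = q ^ (k + 1 + (s + 2)) := (pow_add _ _ _).symm
        _ ≤ q ^ (2 * s + 2) := Nat.pow_le_pow_right hq0 (by omega)
    obtain ⟨y, hy⟩ := Nat.exists_eq_add_of_lt hx
    have hc := wtq_add_wtq_complement hq2 (a := 1) (by omega) (hy.symm.trans (one_mul _).symm)
    rw [hsub, show q ^ (2 * s + 2) - (q - 1) * q ^ k - (i * q ^ (s + 2) - i) = y by omega]
    have e : (q - 1) * (2 * s + 2) = (q - 1) * l + (q - 1) * k + (q - 1) := by
      rw [show 2 * s + 2 = l + k + 1 by omega]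
      ring
    omega
end
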